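/- Let (V,g,J) be a 2m-dimensional Euclidean vector space with an orthogonal complex structure J, and let {e_i} be an orthonormal basis. Then the operator Σ_{i,k} (e_i∧Je_i)⋆(e_k∧Je_k)⋆ equals 4(J⋆)²; hence it equals −4·id on V, equals −16·pr₋ on End(V), and, when dim V = 6, it equals α ↦ −12α + 8α̂ on 3-forms α, where α̂(X,Y,Z) := α(JX,JY,Z) + α(JX,Y,JZ) + α(X,JY,JZ). -/

import Mathlib

noncomputable section

open scoped RealInnerProductSpace

/-- The derivation action of an endomorphism `B` of `V` on covariant `p`-tensors on `V`
(for a `p`-form `u` it is given by `B⋆u = −B*(e_i) ∧ e_i ⌟ u`, i.e.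
`(B⋆u)(v₁,…,v_p) = −∑ᵢ u(v₁,…,B vᵢ,…,v_p)`). -/
def act {V : Type*} [AddCommGroup V] [Module ℝ V] {p : ℕ}
    (B : V →ₗ[ℝ] V) (u : (Fin p → V) → ℝ) : (Fin p → V) → ℝ :=
  fun f => -∑ i, u (Function.update f i (B (f i)))

/-- The derivation action of an endomorphism on endomorphisms: the commutator `B⋆H = [B, H]`. -/
def actE {V : Type*} [AddCommGroup V] [Module ℝ V] (B H : V →ₗ[ℝ] V) : V →ₗ[ℝ] V :=
  B ∘ₗ H - H ∘ₗ B

/-- The 2-vector `v ∧ w` viewed as a skew-symmetric endomorphism: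
`(v ∧ w)(z) = ⟨v,z⟩ w − ⟨w,z⟩ v`. -/
def wE {V : Type*} [NormedAddCommGroup V] [InnerProductSpace ℝ V] (v w : V) : V →ₗ[ℝ] V :=
  LinearMap.smulRight (innerSL ℝ v).toLinearMap w
    - LinearMap.smulRight (innerSL ℝ w).toLinearMap v

/-- For a 3-form `α`, the 3-form `α̂(X,Y,Z) = α(JX,JY,Z) + α(JX,Y,JZ) + α(X,JY,JZ)`. -/
def hat3 {V : Type*} [AddCommGroup V] [Module ℝ V] (J : V →ₗ[ℝ] V) (α : (Fin 3 → V) → ℝ) :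
    (Fin 3 → V) → ℝ :=
  fun f => α ![J (f 0), J (f 1), f 2] + α ![J (f 0), f 1, J (f 2)] + α ![f 0, J (f 1), J (f 2)]


theorem sum_wE_apply_orthonormalBasis {ι V : Type*} [Fintype ι] [NormedAddCommGroup V]
    [InnerProductSpace ℝ V] {J : V →ₗ[ℝ] V} (hJsq : ∀ v, J (J v) = -v)
    (hJorth : ∀ v w, ⟪J v, J w⟫ = ⟪v, w⟫) (b : OrthonormalBasis ι ℝ V) :
    ∑ i, wE (b i) (J (b i)) = (2 : ℝ) • J := by
  have hskew (v w : V) : ⟪J v, w⟫ = -⟪v, J w⟫ := by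
    rw [← hJorth v (J w), hJsq, inner_neg_right, neg_neg]
  ext v
  have hJv : ∑ i, ⟪b i, v⟫ • J (b i) = J v := by
    conv_rhs => rw [← b.sum_repr' v]
    simp only [map_sum, map_smul]
  simp [wE, hskew, hJv, b.sum_repr' (J v), two_smul]

/-- `act B` preserves multilinearity. -/
theorem exists_multilinearMap_coe_eq_act {V : Type*} [AddCommGroup V] [Module ℝ V] {p : ℕ}
    (B : V →ₗ[ℝ] V) (u : MultilinearMap ℝ (fun _ : Fin p => V) ℝ) :
    ∃ w : MultilinearMap ℝ (fun _ : Fin p => V) ℝ, ⇑w = act B ⇑u := by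
  refine ⟨-∑ i, u.compLinearMap (Function.update (fun _ => LinearMap.id) i B), ?_⟩
  ext f
  simp only [neg_apply, sum_apply,
    MultilinearMap.compLinearMap_apply, act]
  congr! 3 with i
  ext j
  rcases eq_or_ne j i with rfl | h <;> simp [*]

theorem sum_act {ι V : Type*} [Fintype ι] [AddCommGroup V] [Module ℝ V] {p : ℕ}
    (B : ι → V →ₗ[ℝ] V) (u : MultilinearMap ℝ (fun _ : Fin p => V) ℝ) :
    ∑ k, act (B k) ⇑u = act (∑ k, B k) ⇑u := by
  ext f
  simp only [act, Finset.sum_apply, LinearMap.sum_apply, MultilinearMap.map_update_sum,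
    Finset.sum_neg_distrib]
  rw [Finset.sum_comm]

theorem smul_act {V : Type*} [AddCommGroup V] [Module ℝ V] {p : ℕ} (c : ℝ)
    (B : V →ₗ[ℝ] V) (u : MultilinearMap ℝ (fun _ : Fin p => V) ℝ) :
    act (c • B) ⇑u = c • act B ⇑u := by
  ext f
  simp [act, MultilinearMap.map_update_smul, Finset.mul_sum]

theorem act_sum {ι V : Type*} [Fintype ι] [AddCommGroup V] [Module ℝ V] {p : ℕ}
    (B : V →ₗ[ℝ] V) (u : ι → (Fin p → V) → ℝ) :
    ∑ k, act B (u k) = act B (∑ k, u k) := by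
  ext f
  simp only [act, Finset.sum_apply, Finset.sum_neg_distrib]
  rw [Finset.sum_comm]

theorem act_smul {V : Type*} [AddCommGroup V] [Module ℝ V] {p : ℕ} (c : ℝ)
    (B : V →ₗ[ℝ] V) (u : (Fin p → V) → ℝ) : act B (c • u) = c • act B u := by
  ext f
  simp [act, Finset.mul_sum]

theorem sum_actE_actE {ι V : Type*} [Fintype ι] [AddCommGroup V] [Module ℝ V]
    (B : ι → V →ₗ[ℝ] V) (H : V →ₗ[ℝ] V) :
    ∑ i, ∑ k, actE (B i) (actE (B k) H) = actE (∑ i, B i) (actE (∑ k, B k) H) := by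
  simp only [actE, ← Module.End.mul_eq_comp, Finset.sum_sub_distrib, Finset.sum_mul,
    Finset.mul_sum, mul_sub, sub_mul]
  congr 2 <;> rw [Finset.sum_comm]

theorem sum_act_act {ι V : Type*} [Fintype ι] [AddCommGroup V] [Module ℝ V] {p : ℕ}
    (B : ι → V →ₗ[ℝ] V) (u : MultilinearMap ℝ (fun _ : Fin p => V) ℝ) :
    ∑ i, ∑ k, act (B i) (act (B k) ⇑u) = act (∑ i, B i) (act (∑ k, B k) ⇑u) := by
  simp only [act_sum, sum_act]
  obtain ⟨w, hw⟩ := exists_multilinearMap_coe_eq_act (∑ k, B k) u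
  rw [← hw, sum_act]

theorem act_act_complexStructure {V : Type*} [AddCommGroup V] [Module ℝ V] {J : V →ₗ[ℝ] V}
    (hJsq : ∀ v, J (J v) = -v) (u : MultilinearMap ℝ (fun _ : Fin 3 => V) ℝ) :
    act J (act J ⇑u) = (-3 : ℝ) • ⇑u + (2 : ℝ) • hat3 J ⇑u := by
  ext f
  obtain ⟨x, y, z, rfl⟩ : ∃ x y z, f = ![x, y, z] :=
    ⟨f 0, f 1, f 2, by ext i; fin_cases i <;> rfl⟩
  have h0 (a b c d : V) : Function.update ![a, b, c] 0 d = ![d, b, c] := by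
    ext i; fin_cases i <;> rfl
  have h1 (a b c d : V) : Function.update ![a, b, c] 1 d = ![a, d, c] := by
    ext i; fin_cases i <;> rfl
  have h2 (a b c d : V) : Function.update ![a, b, c] 2 d = ![a, b, d] := by
    ext i; fin_cases i <;> rfl
  have n0 : u ![-x, y, z] = -u ![x, y, z] := by
    simpa only [h0] using u.map_update_neg ![x, y, z] 0 x
  have n1 : u ![x, -y, z] = -u ![x, y, z] := by
    simpa only [h1] using u.map_update_neg ![x, y, z] 1 y
  have n2 : u ![x, y, -z] = -u ![x, y, z] := by
    simpa only [h2] using u.map_update_neg ![x, y, z] 2 z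
  simp only [act, Fin.sum_univ_three, h0, h1, h2, hat3, Pi.add_apply, Pi.smul_apply,
    smul_eq_mul, Matrix.cons_val, hJsq, n0, n1, n2]
  ring

/-- In a `2m`-dimensional Euclidean vector space with orthogonal complex
structure `J` and orthonormal basis `{e_i}`, the operator `Σ (e_i∧Je_i)⋆(e_k∧Je_k)⋆` equals
`4(J⋆)²` (here stated on multilinear covariant tensors and on endomorphisms); hence it equals
`−4·id` on `V`, `−16·pr₋` on `End(V)`, and (when `dim V = 6`) `α ↦ −12α + 8α̂` on 3-forms. -/
theorem sum_eiJei_ekJek {V : Type*} [NormedAddCommGroup V] [InnerProductSpace ℝ V]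
    (m : ℕ) (J : V →ₗ[ℝ] V) (hJsq : ∀ v, J (J v) = -v)
    (hJorth : ∀ v w, ⟪J v, J w⟫ = ⟪v, w⟫)
    (b : OrthonormalBasis (Fin (2 * m)) ℝ V) :
    (∀ (p : ℕ) (u : MultilinearMap ℝ (fun _ : Fin p => V) ℝ),
        (∑ i, ∑ k, act (wE (b i) (J (b i))) (act (wE (b k) (J (b k))) ⇑u))
          = (4 : ℝ) • act J (act J ⇑u))
    ∧ (∀ H : V →ₗ[ℝ] V,
        (∑ i, ∑ k, actE (wE (b i) (J (b i))) (actE (wE (b k) (J (b k))) H))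
          = (4 : ℝ) • actE J (actE J H))
    ∧ (∀ v : V, (∑ i, ∑ k, wE (b i) (J (b i)) (wE (b k) (J (b k)) v)) = (-4 : ℝ) • v)
    ∧ (∀ H : V →ₗ[ℝ] V,
        (∑ i, ∑ k, actE (wE (b i) (J (b i))) (actE (wE (b k) (J (b k))) H))
          = (-16 : ℝ) • ((1/2 : ℝ) • (H + J ∘ₗ H ∘ₗ J)))
    ∧ (m = 3 → ∀ α : AlternatingMap ℝ V ℝ (Fin 3),
        (∑ i, ∑ k, act (wE (b i) (J (b i))) (act (wE (b k) (J (b k))) ⇑α))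
          = (-12 : ℝ) • ⇑α + (8 : ℝ) • hat3 J ⇑α) := by
  have hsum := sum_wE_apply_orthonormalBasis hJsq hJorth b
  have htensor (p : ℕ) (u : MultilinearMap ℝ (fun _ : Fin p => V) ℝ) :
      (∑ i, ∑ k, act (wE (b i) (J (b i))) (act (wE (b k) (J (b k))) ⇑u))
        = (4 : ℝ) • act J (act J ⇑u) := by
    obtain ⟨w, hw⟩ := exists_multilinearMap_coe_eq_act J u
    rw [sum_act_act, hsum, smul_act, act_smul, ← hw, smul_act, smul_smul]
    norm_num
  have hend (H : V →ₗ[ℝ] V) :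
      (∑ i, ∑ k, actE (wE (b i) (J (b i))) (actE (wE (b k) (J (b k))) H))
        = (4 : ℝ) • actE J (actE J H) := by
    rw [sum_actE_actE, hsum]
    ext v
    simp only [actE, LinearMap.sub_apply, LinearMap.comp_apply, LinearMap.smul_apply, map_sub,
      map_smul]
    module
  refine ⟨htensor, hend, fun v => ?_, fun H => ?_, fun _ α => ?_⟩
  · simp_rw [← map_sum, ← LinearMap.sum_apply, hsum, LinearMap.smul_apply, map_smul, hJsq]
    module
  · rw [hend]
    ext v
    simp only [actE, LinearMap.sub_apply, LinearMap.comp_apply, LinearMap.smul_apply,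
      LinearMap.add_apply, map_sub, map_neg, hJsq]
    module
  · have h := htensor 3 α.toMultilinearMap
    rw [act_act_complexStructure hJsq] at h
    refine h.trans ?_
    simp only [AlternatingMap.coe_multilinearMap]
    module
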